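/- arXiv:1406.0299 — 5 statements merged into one kernel-verified Lean document; each statement's English description precedes it below -/
import Mathlib

section
/- Let A be a unital associative algebra over ℂ and Δ : A → A ⊗ A a multiplicative linear map. Suppose E ∈ A ⊗ A is an idempotent (E·E = E) such that the linear span of {Δ(a)·z : a ∈ A, z ∈ A ⊗ A} equals {E·z : z ∈ A ⊗ A} and the linear span of {z·Δ(a) : a ∈ A, z ∈ A ⊗ A} equals {z·E : z ∈ A ⊗ A}. Then: (i) any idempotent E' ∈ A ⊗ A satisfying the same two conditions equals E; (ii) E·Δ(a) = Δ(a)·E = Δ(a) for all a ∈ A; (iii) E is the smallest idempotent with property (ii), i.e. every idempotent G ∈ A ⊗ A with G·Δ(a) = Δ(a)·G = Δ(a) for all a ∈ A satisfies E·G = G·E = E. -/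
open TensorProduct

/-- Slice map `id ⊗ ω` landing in the left tensor factor. -/
noncomputable def sL {B C : Type} [AddCommGroup B] [Module ℂ B] [AddCommGroup C] [Module ℂ C]
    (ω : C →ₗ[ℂ] ℂ) : (B ⊗[ℂ] C) →ₗ[ℂ] B :=
  (TensorProduct.rid ℂ B).toLinearMap ∘ₗ LinearMap.lTensor B ω

/-- Slice map `ω ⊗ id` landing in the right tensor factor. -/
noncomputable def sR {B C : Type} [AddCommGroup B] [Module ℂ B] [AddCommGroup C] [Module ℂ C]
    (ω : B →ₗ[ℂ] ℂ) : (B ⊗[ℂ] C) →ₗ[ℂ] C :=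
  (TensorProduct.lid ℂ C).toLinearMap ∘ₗ LinearMap.rTensor C ω

/-- A left multiplier fixing every `f a` fixes the right ideal generated by the range of `f`. -/
theorem mul_eq_of_mem_span_mul {ι R B : Type*} [CommSemiring R] [Semiring B] [Algebra R B]
    {f : ι → B} {g : B} (hg : ∀ a, g * f a = f a) {y : B}
    (hy : y ∈ Submodule.span R {y : B | ∃ a z, y = f a * z}) : g * y = y := by
  have hle : Submodule.span R {y : B | ∃ a z, y = f a * z} ≤
      LinearMap.eqLocus (LinearMap.mulLeft R g) LinearMap.id := by
    rw [Submodule.span_le]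
    rintro _ ⟨a, z, rfl⟩
    simp [← mul_assoc, hg]
  simpa using hle hy

/-- A right multiplier fixing every `f a` fixes the left ideal generated by the range of `f`. -/
theorem mul_eq_of_mem_span_mul_right {ι R B : Type*} [CommSemiring R] [Semiring B] [Algebra R B]
    {f : ι → B} {g : B} (hg : ∀ a, f a * g = f a) {y : B}
    (hy : y ∈ Submodule.span R {y : B | ∃ a z, y = z * f a}) : y * g = y := by
  have hle : Submodule.span R {y : B | ∃ a z, y = z * f a} ≤
      LinearMap.eqLocus (LinearMap.mulRight R g) LinearMap.id := by
    rw [Submodule.span_le]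
    rintro _ ⟨a, z, rfl⟩
    simp [mul_assoc, hg]
  simpa using hle hy

theorem statement0 (A : Type) [Ring A] [Algebra ℂ A]
    (Δ : A →ₗ[ℂ] A ⊗[ℂ] A)
    (hΔmul : ∀ a a' : A, Δ (a * a') = Δ a * Δ a')
    (E : A ⊗[ℂ] A) (hEE : E * E = E)
    (hranL : (Submodule.span ℂ {y : A ⊗[ℂ] A | ∃ a z, y = Δ a * z} : Set (A ⊗[ℂ] A)) =
      {y : A ⊗[ℂ] A | ∃ z, y = E * z})
    (hranR : (Submodule.span ℂ {y : A ⊗[ℂ] A | ∃ a z, y = z * Δ a} : Set (A ⊗[ℂ] A)) =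
      {y : A ⊗[ℂ] A | ∃ z, y = z * E}) :
    (∀ E₀ : A ⊗[ℂ] A, E₀ * E₀ = E₀ →
      (Submodule.span ℂ {y : A ⊗[ℂ] A | ∃ a z, y = Δ a * z} : Set (A ⊗[ℂ] A)) =
        {y : A ⊗[ℂ] A | ∃ z, y = E₀ * z} →
      (Submodule.span ℂ {y : A ⊗[ℂ] A | ∃ a z, y = z * Δ a} : Set (A ⊗[ℂ] A)) =
        {y : A ⊗[ℂ] A | ∃ z, y = z * E₀} →
      E₀ = E) ∧
    (∀ a : A, E * Δ a = Δ a ∧ Δ a * E = Δ a) ∧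
    (∀ G : A ⊗[ℂ] A, G * G = G → (∀ a : A, G * Δ a = Δ a ∧ Δ a * G = Δ a) →
      E * G = E ∧ G * E = E) := by
  refine ⟨fun E₀ hE₀ hL hR => ?_, fun a => ⟨?_, ?_⟩, fun G _ hG => ⟨?_, ?_⟩⟩
  · obtain ⟨z, hz⟩ : E ∈ {y : A ⊗[ℂ] A | ∃ z, y = E₀ * z} := by
      rw [← hL, hranL]
      exact ⟨1, (mul_one E).symm⟩
    obtain ⟨w, hw⟩ : E₀ ∈ {y : A ⊗[ℂ] A | ∃ z, y = z * E} := by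
      rw [← hranR, hR]
      exact ⟨1, (one_mul E₀).symm⟩
    calc E₀ = E₀ * E := by rw [hw, mul_assoc, hEE]
      _ = E := by rw [hz, ← mul_assoc, hE₀]
  · obtain ⟨z, hz⟩ : Δ a ∈ {y : A ⊗[ℂ] A | ∃ z, y = E * z} := by
      rw [← hranL]
      exact Submodule.subset_span ⟨a, 1, (mul_one _).symm⟩
    rw [hz, ← mul_assoc, hEE]
  · obtain ⟨z, hz⟩ : Δ a ∈ {y : A ⊗[ℂ] A | ∃ z, y = z * E} := by
      rw [← hranR]
      exact Submodule.subset_span ⟨a, 1, (one_mul _).symm⟩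
    rw [hz, mul_assoc, hEE]
  · refine mul_eq_of_mem_span_mul_right (R := ℂ) (fun a => (hG a).2) ?_
    rw [← SetLike.mem_coe, hranR]
    exact ⟨1, (one_mul E).symm⟩
  · refine mul_eq_of_mem_span_mul (R := ℂ) (fun a => (hG a).1) ?_
    rw [← SetLike.mem_coe, hranL]
    exact ⟨1, (mul_one E).symm⟩
end

section
/- Let B and C be unital associative algebras over ℂ and let E ∈ B ⊗ C be an idempotent (E·E = E) which is full, i.e. the slices (id_B ⊗ ω)(E), for ω ranging over all linear functionals on C, span B, and the slices (ω ⊗ id_C)(E), for ω ranging over all linear functionals on B, span C. Assume the regularity conditions: the linear span of {E·(b ⊗ 1) : b ∈ B} equals the linear span of {E·(1 ⊗ c) : c ∈ C}, and the linear span of {(b ⊗ 1)·E : b ∈ B} equals the linear span of {(1 ⊗ c)·E : c ∈ C}. Then there exist bijective linear maps S_B : B → C and S_C : C → B that are anti-multiplicative (S_B(b b') = S_B(b') S_B(b) for all b, b' ∈ B and S_C(c c') = S_C(c') S_C(c) for all c, c' ∈ C) and satisfy E·(b ⊗ 1) = E·(1 ⊗ S_B(b)) for all b ∈ B and (1 ⊗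 c)·E = (S_C(c) ⊗ 1)·E for all c ∈ C. -/
open TensorProduct

/-- Two injective linear maps whose ranges agree factor through a linear equivalence. -/
theorem exists_linearEquiv_of_span_eq {R M N P : Type*} [Ring R] [AddCommGroup M] [Module R M]
    [AddCommGroup N] [Module R N] [AddCommGroup P] [Module R P] (f : M →ₗ[R] P) (g : N →ₗ[R] P)
    (hf : ∀ x, f x = 0 → x = 0) (hg : ∀ y, g y = 0 → y = 0)
    (h : Submodule.span R {z | ∃ x, z = f x} = Submodule.span R {z | ∃ y, z = g y}) :
    ∃ e : M ≃ₗ[R] N, ∀ x, f x = g (e x) := by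
  have hfi : Function.Injective f := (injective_iff_map_eq_zero f).2 hf
  have hgi : Function.Injective g := (injective_iff_map_eq_zero g).2 hg
  have hf' : {z | ∃ x, z = f x} = (LinearMap.range f : Set P) := by ext; simp [eq_comm]
  have hg' : {z | ∃ y, z = g y} = (LinearMap.range g : Set P) := by ext; simp [eq_comm]
  rw [hf', hg', Submodule.span_eq, Submodule.span_eq] at h
  let eg := LinearEquiv.ofInjective g hgi
  refine ⟨LinearEquiv.ofInjective f hfi ≪≫ₗ LinearEquiv.ofEq _ _ h ≪≫ₗ eg.symm, fun x => ?_⟩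
  have key := congrArg Subtype.val
    (eg.apply_symm_apply (LinearEquiv.ofEq _ _ h (LinearEquiv.ofInjective f hfi x)))
  exact key.symm

section Slices

variable {B C : Type} [Ring B] [Algebra ℂ B] [Ring C] [Algebra ℂ C]

theorem sL_mul_tmul_one (ω : C →ₗ[ℂ] ℂ) (z : B ⊗[ℂ] C) (b : B) :
    sL ω (z * (b ⊗ₜ[ℂ] (1 : C))) = sL ω z * b := by
  induction z with
  | zero => simp
  | add x y hx hy => simp only [add_mul, map_add, hx, hy]
  | tmul x y => simp [sL]

theorem sL_tmul_one_mul (ω : C →ₗ[ℂ] ℂ) (z : B ⊗[ℂ] C) (b : B) :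
    sL ω ((b ⊗ₜ[ℂ] (1 : C)) * z) = b * sL ω z := by
  induction z with
  | zero => simp
  | add x y hx hy => simp only [mul_add, map_add, hx, hy]
  | tmul x y => simp [sL]

theorem sR_mul_one_tmul (ω : B →ₗ[ℂ] ℂ) (z : B ⊗[ℂ] C) (c : C) :
    sR ω (z * ((1 : B) ⊗ₜ[ℂ] c)) = sR ω z * c := by
  induction z with
  | zero => simp
  | add x y hx hy => simp only [add_mul, map_add, hx, hy]
  | tmul x y => simp [sR]

theorem sR_one_tmul_mul (ω : B →ₗ[ℂ] ℂ) (z : B ⊗[ℂ] C) (c : C) :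
    sR ω (((1 : B) ⊗ₜ[ℂ] c) * z) = c * sR ω z := by
  induction z with
  | zero => simp
  | add x y hx hy => simp only [mul_add, map_add, hx, hy]
  | tmul x y => simp [sR]

theorem eq_zero_of_forall_mul_eq_zero {A : Type*} [Ring A] [Algebra ℂ A] {s : Set A}
    (hs : Submodule.span ℂ s = ⊤) {a : A} (h : ∀ x ∈ s, x * a = 0) : a = 0 := by
  have key : LinearMap.mulRight ℂ a = 0 := LinearMap.ext_on hs fun x hx => h x hx
  simpa using LinearMap.congr_fun key 1

theorem eq_zero_of_forall_eq_zero_mul {A : Type*} [Ring A] [Algebra ℂ A] {s : Set A}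
    (hs : Submodule.span ℂ s = ⊤) {a : A} (h : ∀ x ∈ s, a * x = 0) : a = 0 := by
  have key : LinearMap.mulLeft ℂ a = 0 := LinearMap.ext_on hs fun x hx => h x hx
  simpa using LinearMap.congr_fun key 1

variable {E : B ⊗[ℂ] C}

theorem eq_zero_of_mul_tmul_one
    (hfull : Submodule.span ℂ {x : B | ∃ ω : C →ₗ[ℂ] ℂ, x = sL ω E} = ⊤) (b : B)
    (h : E * (b ⊗ₜ[ℂ] (1 : C)) = 0) : b = 0 := by
  refine eq_zero_of_forall_mul_eq_zero hfull ?_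
  rintro _ ⟨ω, rfl⟩
  rw [← sL_mul_tmul_one, h, map_zero]

theorem eq_zero_of_tmul_one_mul
    (hfull : Submodule.span ℂ {x : B | ∃ ω : C →ₗ[ℂ] ℂ, x = sL ω E} = ⊤) (b : B)
    (h : (b ⊗ₜ[ℂ] (1 : C)) * E = 0) : b = 0 := by
  refine eq_zero_of_forall_eq_zero_mul hfull ?_
  rintro _ ⟨ω, rfl⟩
  rw [← sL_tmul_one_mul, h, map_zero]

theorem eq_zero_of_mul_one_tmul
    (hfull : Submodule.span ℂ {y : C | ∃ ω : B →ₗ[ℂ] ℂ, y = sR ω E} = ⊤) (c : C)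
    (h : E * ((1 : B) ⊗ₜ[ℂ] c) = 0) : c = 0 := by
  refine eq_zero_of_forall_mul_eq_zero hfull ?_
  rintro _ ⟨ω, rfl⟩
  rw [← sR_mul_one_tmul, h, map_zero]

theorem eq_zero_of_one_tmul_mul
    (hfull : Submodule.span ℂ {y : C | ∃ ω : B →ₗ[ℂ] ℂ, y = sR ω E} = ⊤) (c : C)
    (h : ((1 : B) ⊗ₜ[ℂ] c) * E = 0) : c = 0 := by
  refine eq_zero_of_forall_eq_zero_mul hfull ?_
  rintro _ ⟨ω, rfl⟩
  rw [← sR_one_tmul_mul, h, map_zero]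

end Slices

theorem statement1 (B C : Type) [Ring B] [Algebra ℂ B] [Ring C] [Algebra ℂ C]
    (E : B ⊗[ℂ] C) (hEE : E * E = E)
    (hfullB : Submodule.span ℂ {x : B | ∃ ω : C →ₗ[ℂ] ℂ, x = sL ω E} = ⊤)
    (hfullC : Submodule.span ℂ {y : C | ∃ ω : B →ₗ[ℂ] ℂ, y = sR ω E} = ⊤)
    (hreg1 : Submodule.span ℂ {z : B ⊗[ℂ] C | ∃ b : B, z = E * (b ⊗ₜ[ℂ] (1 : C))} =
      Submodule.span ℂ {z : B ⊗[ℂ] C | ∃ c : C, z = E * ((1 : B) ⊗ₜ[ℂ] c)})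
    (hreg2 : Submodule.span ℂ {z : B ⊗[ℂ] C | ∃ b : B, z = (b ⊗ₜ[ℂ] (1 : C)) * E} =
      Submodule.span ℂ {z : B ⊗[ℂ] C | ∃ c : C, z = ((1 : B) ⊗ₜ[ℂ] c) * E}) :
    ∃ (SB : B →ₗ[ℂ] C) (SC : C →ₗ[ℂ] B),
      Function.Bijective SB ∧ Function.Bijective SC ∧
      (∀ b b' : B, SB (b * b') = SB b' * SB b) ∧
      (∀ c c' : C, SC (c * c') = SC c' * SC c) ∧
      (∀ b : B, E * (b ⊗ₜ[ℂ] (1 : C)) = E * ((1 : B) ⊗ₜ[ℂ] SB b)) ∧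
      (∀ c : C, ((1 : B) ⊗ₜ[ℂ] c) * E = (SC c ⊗ₜ[ℂ] (1 : C)) * E) := by
  let ιB : B →ₗ[ℂ] B ⊗[ℂ] C := (TensorProduct.mk ℂ B C).flip 1
  let ιC : C →ₗ[ℂ] B ⊗[ℂ] C := TensorProduct.mk ℂ B C 1
  obtain ⟨SB, hSB⟩ := exists_linearEquiv_of_span_eq
    (LinearMap.mulLeft ℂ E ∘ₗ ιB) (LinearMap.mulLeft ℂ E ∘ₗ ιC)
    (eq_zero_of_mul_tmul_one hfullB) (eq_zero_of_mul_one_tmul hfullC) hreg1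
  obtain ⟨SC, hSC⟩ := exists_linearEquiv_of_span_eq
    (LinearMap.mulRight ℂ E ∘ₗ ιC) (LinearMap.mulRight ℂ E ∘ₗ ιB)
    (eq_zero_of_one_tmul_mul hfullC) (eq_zero_of_tmul_one_mul hfullB) hreg2.symm
  replace hSB : ∀ b : B, E * (b ⊗ₜ[ℂ] (1 : C)) = E * ((1 : B) ⊗ₜ[ℂ] SB b) := hSB
  replace hSC : ∀ c : C, ((1 : B) ⊗ₜ[ℂ] c) * E = (SC c ⊗ₜ[ℂ] (1 : C)) * E := hSC
  have hcomm (b : B) (c : C) : ((1 : B) ⊗ₜ[ℂ] c) * (b ⊗ₜ[ℂ] (1 : C)) =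
      (b ⊗ₜ[ℂ] (1 : C)) * ((1 : B) ⊗ₜ[ℂ] c) := by simp
  have hB (b b' : B) : (b * b') ⊗ₜ[ℂ] (1 : C) = (b ⊗ₜ[ℂ] 1) * (b' ⊗ₜ[ℂ] 1) := by simp
  have hC (c c' : C) : (1 : B) ⊗ₜ[ℂ] (c * c') = (1 ⊗ₜ[ℂ] c) * (1 ⊗ₜ[ℂ] c') := by simp
  refine ⟨SB, SC, SB.bijective, SC.bijective, fun b b' => ?_, fun c c' => ?_, hSB, hSC⟩
  · refine sub_eq_zero.1 (eq_zero_of_mul_one_tmul hfullC _ ?_)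
    rw [TensorProduct.tmul_sub, mul_sub, sub_eq_zero]
    calc E * (1 ⊗ₜ[ℂ] SB (b * b'))
        = E * (b ⊗ₜ[ℂ] 1) * (b' ⊗ₜ[ℂ] 1) := by rw [← hSB, hB, mul_assoc]
      _ = E * (b' ⊗ₜ[ℂ] 1) * (1 ⊗ₜ[ℂ] SB b) := by rw [hSB, mul_assoc, hcomm, mul_assoc]
      _ = E * (1 ⊗ₜ[ℂ] (SB b' * SB b)) := by rw [hSB, hC, mul_assoc]
  · refine sub_eq_zero.1 (eq_zero_of_tmul_one_mul hfullB _ ?_)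
    rw [TensorProduct.sub_tmul, sub_mul, sub_eq_zero]
    calc (SC (c * c') ⊗ₜ[ℂ] 1) * E
        = (1 ⊗ₜ[ℂ] c) * ((1 ⊗ₜ[ℂ] c') * E) := by rw [← hSC, hC, mul_assoc]
      _ = (SC c' ⊗ₜ[ℂ] 1) * ((1 ⊗ₜ[ℂ] c) * E) := by
        rw [hSC c', ← mul_assoc, hcomm, mul_assoc]
      _ = ((SC c' * SC c) ⊗ₜ[ℂ] 1) * E := by rw [hSC, hB, mul_assoc]
end

section
/- Let A be a unital associative algebra over ℂ and let B and C be unital subalgebras of A containing the unit of A. Suppose E is an element of A ⊗ A lying in the image of B ⊗ C and, viewed as an element of B ⊗ C, E is a regular separability idempotent. Then: (i) E·(a ⊗ 1) lies in the image of A ⊗ C in A ⊗ A for every a ∈ A, and for every linear subspace V of A such that E·(a ⊗ 1) lies in the image of A ⊗ V for all a ∈ A, one has C ⊆ V (so C is the smallest such subspace); (ii) (1 ⊗ a)·E lies in the image of B ⊗ A in A ⊗ A for every a ∈ A, and for every linear subspace V of A such that (1 ⊗ a)·E lies in the image of V ⊗ A for all a ∈ A, one has B ⊆ V. In particular B and C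 are completely determined by E. -/
open TensorProduct

section Slices

variable {M N M' N' : Type} [AddCommGroup M] [Module ℂ M] [AddCommGroup N] [Module ℂ N]
  [AddCommGroup M'] [Module ℂ M'] [AddCommGroup N'] [Module ℂ N']

theorem sL_tmul (ω : N →ₗ[ℂ] ℂ) (x : M) (y : N) : sL ω (x ⊗ₜ[ℂ] y) = ω y • x := by
  simp [sL]

theorem sR_tmul (ω : M →ₗ[ℂ] ℂ) (x : M) (y : N) : sR ω (x ⊗ₜ[ℂ] y) = ω x • y := by
  simp [sR]

theorem sL_map (f : M →ₗ[ℂ] M') (g : N →ₗ[ℂ] N') (ω : N' →ₗ[ℂ] ℂ) (t : M ⊗[ℂ] N) :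
    sL ω (TensorProduct.map f g t) = f (sL (ω ∘ₗ g) t) := by
  induction t with
  | zero => simp
  | tmul x y => simp [sL_tmul]
  | add s t hs ht => simp [hs, ht]

theorem sR_map (f : M →ₗ[ℂ] M') (g : N →ₗ[ℂ] N') (ω : M' →ₗ[ℂ] ℂ) (t : M ⊗[ℂ] N) :
    sR ω (TensorProduct.map f g t) = g (sR (ω ∘ₗ f) t) := by
  induction t with
  | zero => simp
  | tmul x y => simp [sR_tmul]
  | add s t hs ht => simp [hs, ht]

theorem sL_mem (V : Submodule ℂ M) (ω : N →ₗ[ℂ] ℂ) {t : M ⊗[ℂ] N}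
    (ht : t ∈ Submodule.span ℂ {z : M ⊗[ℂ] N | ∃ x : N, ∃ v ∈ V, z = v ⊗ₜ[ℂ] x}) :
    sL ω t ∈ V := by
  refine (Submodule.span_le (p := V.comap (sL ω))).2 ?_ ht
  rintro _ ⟨x, v, hv, rfl⟩
  simpa [sL_tmul] using V.smul_mem (ω x) hv

theorem sR_mem (V : Submodule ℂ N) (ω : M →ₗ[ℂ] ℂ) {t : M ⊗[ℂ] N}
    (ht : t ∈ Submodule.span ℂ {z : M ⊗[ℂ] N | ∃ x : M, ∃ v ∈ V, z = x ⊗ₜ[ℂ] v}) :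
    sR ω t ∈ V := by
  refine (Submodule.span_le (p := V.comap (sR ω))).2 ?_ ht
  rintro _ ⟨x, v, hv, rfl⟩
  simpa [sR_tmul] using V.smul_mem (ω x) hv

/-- If the left slices of `t` span `M`, any subspace `V` with `(f ⊗ g) t ∈ V ⊗ N'` contains the
range of `f`, provided `g` is injective. -/
theorem range_le_of_map_mem_left (f : M →ₗ[ℂ] M') (g : N →ₗ[ℂ] N')
    (hg : Function.Injective g) (t : M ⊗[ℂ] N)
    (hfull : Submodule.span ℂ {x : M | ∃ ω : N →ₗ[ℂ] ℂ, x = sL ω t} = ⊤)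
    (V : Submodule ℂ M') (ht : TensorProduct.map f g t ∈
      Submodule.span ℂ {z : M' ⊗[ℂ] N' | ∃ x : N', ∃ v ∈ V, z = v ⊗ₜ[ℂ] x}) :
    LinearMap.range f ≤ V := by
  obtain ⟨r, hr⟩ := g.exists_leftInverse_of_injective (LinearMap.ker_eq_bot.2 hg)
  rw [LinearMap.range_eq_map, ← hfull, Submodule.map_le_iff_le_comap, Submodule.span_le]
  rintro _ ⟨ω, rfl⟩
  have h := sL_mem V (ω ∘ₗ r) ht
  rwa [sL_map, LinearMap.comp_assoc, hr, LinearMap.comp_id] at h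

/-- If the right slices of `t` span `N`, any subspace `V` with `(f ⊗ g) t ∈ M' ⊗ V` contains the
range of `g`, provided `f` is injective. -/
theorem range_le_of_map_mem_right (f : M →ₗ[ℂ] M') (g : N →ₗ[ℂ] N')
    (hf : Function.Injective f) (t : M ⊗[ℂ] N)
    (hfull : Submodule.span ℂ {y : N | ∃ ω : M →ₗ[ℂ] ℂ, y = sR ω t} = ⊤)
    (V : Submodule ℂ N') (ht : TensorProduct.map f g t ∈
      Submodule.span ℂ {z : M' ⊗[ℂ] N' | ∃ x : M', ∃ v ∈ V, z = x ⊗ₜ[ℂ] v}) :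
    LinearMap.range g ≤ V := by
  obtain ⟨r, hr⟩ := f.exists_leftInverse_of_injective (LinearMap.ker_eq_bot.2 hf)
  rw [LinearMap.range_eq_map, ← hfull, Submodule.map_le_iff_le_comap, Submodule.span_le]
  rintro _ ⟨ω, rfl⟩
  have h := sR_mem V (ω ∘ₗ r) ht
  rwa [sR_map, LinearMap.comp_assoc, hr, LinearMap.comp_id] at h

end Slices

theorem statement7
    (A : Type) [Ring A] [Algebra ℂ A]
    (B C : Subalgebra ℂ A)
    (E : A ⊗[ℂ] A)
    (E' : ↥B ⊗[ℂ] ↥C)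
    (hE'E : TensorProduct.map B.val.toLinearMap C.val.toLinearMap E' = E)
    (hEE : E' * E' = E')
    (hE'full1 : Submodule.span ℂ {x : ↥B | ∃ ω : ↥C →ₗ[ℂ] ℂ, x = sL ω E'} = ⊤)
    (hE'full2 : Submodule.span ℂ {y : ↥C | ∃ ω : ↥B →ₗ[ℂ] ℂ, y = sR ω E'} = ⊤)
    (SB : ↥B ≃ₗ[ℂ] ↥C) (SC : ↥C ≃ₗ[ℂ] ↥B)
    (hSBanti : ∀ b b' : ↥B, SB (b * b') = SB b' * SB b)
    (hSCanti : ∀ c c' : ↥C, SC (c * c') = SC c' * SC c)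
    (hSBrel : ∀ b : ↥B, E' * (b ⊗ₜ[ℂ] (1 : ↥C)) = E' * ((1 : ↥B) ⊗ₜ[ℂ] SB b))
    (hSCrel : ∀ c : ↥C, ((1 : ↥B) ⊗ₜ[ℂ] c) * E' = (SC c ⊗ₜ[ℂ] (1 : ↥C)) * E') :
    (∀ a : A, E * (a ⊗ₜ[ℂ] (1 : A)) ∈
      Submodule.span ℂ {z : A ⊗[ℂ] A | ∃ x : A, ∃ v ∈ C, z = x ⊗ₜ[ℂ] v}) ∧
    (∀ V : Submodule ℂ A,
      (∀ a : A, E * (a ⊗ₜ[ℂ] (1 : A)) ∈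
        Submodule.span ℂ {z : A ⊗[ℂ] A | ∃ x : A, ∃ v ∈ V, z = x ⊗ₜ[ℂ] v}) →
      C.toSubmodule ≤ V) ∧
    (∀ a : A, ((1 : A) ⊗ₜ[ℂ] a) * E ∈
      Submodule.span ℂ {z : A ⊗[ℂ] A | ∃ x : A, ∃ v ∈ B, z = v ⊗ₜ[ℂ] x}) ∧
    (∀ V : Submodule ℂ A,
      (∀ a : A, ((1 : A) ⊗ₜ[ℂ] a) * E ∈
        Submodule.span ℂ {z : A ⊗[ℂ] A | ∃ x : A, ∃ v ∈ V, z = v ⊗ₜ[ℂ] x}) →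
      B.toSubmodule ≤ V) := by
  subst hE'E
  refine ⟨fun a => ?_, fun V hV c hc => ?_, fun a => ?_, fun V hV b hb => ?_⟩
  · clear * -
    induction E' with
    | zero => simp
    | tmul b c => exact Submodule.subset_span ⟨b * a, c, c.2, by simp⟩
    | add s t hs ht => simpa only [map_add, add_mul] using add_mem hs ht
  · have h := hV 1
    rw [← Algebra.TensorProduct.one_def, mul_one] at h
    exact range_le_of_map_mem_right B.val.toLinearMap C.val.toLinearMap Subtype.val_injective
      E' hE'full2 V h ⟨⟨c, hc⟩, rfl⟩
  · clear * -
    induction E' with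
    | zero => simp
    | tmul b c => exact Submodule.subset_span ⟨a * c, b, b.2, by simp⟩
    | add s t hs ht => simpa only [map_add, mul_add] using add_mem hs ht
  · have h := hV 1
    rw [← Algebra.TensorProduct.one_def, one_mul] at h
    exact range_le_of_map_mem_left B.val.toLinearMap C.val.toLinearMap Subtype.val_injective
      E' hE'full1 V h ⟨⟨b, hb⟩, rfl⟩
end

section
/- Under the standing hypotheses in the context, for every x ∈ B one has Δ(x) = E·(1 ⊗ x) = (1 ⊗ x)·E, and for every y ∈ C one has Δ(y) = (y ⊗ 1)·E = E·(y ⊗ 1). -/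
open TensorProduct

/-- `u ⊗ v ↦ u ⊗ (v ⊗ 1)`, placing `A ⊗ A` in legs 1 and 2 of the triple tensor product. -/
noncomputable def leg12 (A : Type) [Ring A] [Algebra ℂ A] :
    (A ⊗[ℂ] A) →ₗ[ℂ] A ⊗[ℂ] (A ⊗[ℂ] A) :=
  TensorProduct.map LinearMap.id ((TensorProduct.mk ℂ A A).flip 1)

/-- `u ⊗ v ↦ u ⊗ (1 ⊗ v)`, placing `A ⊗ A` in legs 1 and 3 of the triple tensor product. -/
noncomputable def leg13 (A : Type) [Ring A] [Algebra ℂ A] :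
    (A ⊗[ℂ] A) →ₗ[ℂ] A ⊗[ℂ] (A ⊗[ℂ] A) :=
  TensorProduct.map LinearMap.id (TensorProduct.mk ℂ A A 1)

section Slices

variable {A : Type} [Ring A] [Algebra ℂ A]

theorem sL_tmul_s8 {B C : Type} [AddCommGroup B] [Module ℂ B] [AddCommGroup C] [Module ℂ C]
    (ω : C →ₗ[ℂ] ℂ) (b : B) (c : C) : sL ω (b ⊗ₜ[ℂ] c) = ω c • b := by
  simp [sL]

theorem sR_tmul_s8 {B C : Type} [AddCommGroup B] [Module ℂ B] [AddCommGroup C] [Module ℂ C]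
    (ω : B →ₗ[ℂ] ℂ) (b : B) (c : C) : sR ω (b ⊗ₜ[ℂ] c) = ω b • c := by
  simp [sR]

theorem sR_lTensor (Δ : A →ₗ[ℂ] A ⊗[ℂ] A) (ω : A →ₗ[ℂ] ℂ) (T : A ⊗[ℂ] A) :
    sR ω (LinearMap.lTensor A Δ T) = Δ (sR ω T) := by
  induction T with
  | zero => simp
  | tmul u v => simp [sR_tmul_s8]
  | add s t hs ht => simp [hs, ht]

theorem sR_leg12_mul (ω : A →ₗ[ℂ] ℂ) (T F : A ⊗[ℂ] A) :
    sR ω (leg12 A T * ((1 : A) ⊗ₜ[ℂ] F)) = (sR ω T ⊗ₜ[ℂ] (1 : A)) * F := by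
  induction T with
  | zero => simp
  | tmul u v =>
    simp only [sR_tmul_s8, leg12, TensorProduct.map_tmul, LinearMap.flip_apply, TensorProduct.mk_apply,
      LinearMap.id_apply, Algebra.TensorProduct.tmul_mul_tmul, mul_one,
      ← TensorProduct.smul_tmul', smul_mul_assoc]
  | add s t hs ht => simp [hs, ht, add_mul, TensorProduct.add_tmul]

theorem sR_mul_leg12 (ω : A →ₗ[ℂ] ℂ) (T F : A ⊗[ℂ] A) :
    sR ω (((1 : A) ⊗ₜ[ℂ] F) * leg12 A T) = F * (sR ω T ⊗ₜ[ℂ] (1 : A)) := by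
  induction T with
  | zero => simp
  | tmul u v =>
    simp only [sR_tmul_s8, leg12, TensorProduct.map_tmul, LinearMap.flip_apply, TensorProduct.mk_apply,
      LinearMap.id_apply, Algebra.TensorProduct.tmul_mul_tmul, one_mul,
      ← TensorProduct.smul_tmul', mul_smul_comm]
  | add s t hs ht => simp [hs, ht, mul_add, TensorProduct.add_tmul]

theorem lTensor_sL_assoc_tmul (ω : A →ₗ[ℂ] ℂ) (W : A ⊗[ℂ] A) (v : A) :
    LinearMap.lTensor A (sL ω) (TensorProduct.assoc ℂ A A A (W ⊗ₜ[ℂ] v)) = ω v • W := by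
  induction W with
  | zero => simp
  | tmul a b => simp [sL_tmul_s8]
  | add s t hs ht => simp [hs, ht, TensorProduct.add_tmul]

theorem lTensor_sL_assoc_rTensor (Δ : A →ₗ[ℂ] A ⊗[ℂ] A) (ω : A →ₗ[ℂ] ℂ) (T : A ⊗[ℂ] A) :
    LinearMap.lTensor A (sL ω) (TensorProduct.assoc ℂ A A A (LinearMap.rTensor A Δ T)) =
      Δ (sL ω T) := by
  induction T with
  | zero => simp
  | tmul u v => simp [sL_tmul_s8, lTensor_sL_assoc_tmul]
  | add s t hs ht => simp only [map_add, hs, ht]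

theorem lTensor_sL_leg12_mul (ω : A →ₗ[ℂ] ℂ) (T F : A ⊗[ℂ] A) :
    LinearMap.lTensor A (sL ω) (leg12 A T * ((1 : A) ⊗ₜ[ℂ] F)) =
      T * ((1 : A) ⊗ₜ[ℂ] sL ω F) := by
  induction T with
  | zero => simp
  | tmul u v =>
    induction F with
    | zero => simp
    | tmul a b => simp [sL_tmul_s8, leg12]
    | add s t hs ht => simp only [map_add, TensorProduct.tmul_add, mul_add, hs, ht]
  | add s t hs ht => simp only [map_add, add_mul, hs, ht]

theorem lTensor_sL_mul_leg12 (ω : A →ₗ[ℂ] ℂ) (T F : A ⊗[ℂ] A) :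
    LinearMap.lTensor A (sL ω) (((1 : A) ⊗ₜ[ℂ] F) * leg12 A T) =
      ((1 : A) ⊗ₜ[ℂ] sL ω F) * T := by
  induction T with
  | zero => simp
  | tmul u v =>
    induction F with
    | zero => simp
    | tmul a b => simp [sL_tmul_s8, leg12]
    | add s t hs ht => simp only [map_add, TensorProduct.tmul_add, add_mul, hs, ht]
  | add s t hs ht => simp only [map_add, mul_add, hs, ht]

theorem sL_map_val (B C : Subalgebra ℂ A) (ω : A →ₗ[ℂ] ℂ) (T : ↥B ⊗[ℂ] ↥C) :
    sL ω (TensorProduct.map B.val.toLinearMap C.val.toLinearMap T) =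
      ((sL (ω ∘ₗ C.val.toLinearMap) T : ↥B) : A) := by
  induction T with
  | zero => simp
  | tmul u v => simp [sL_tmul_s8]
  | add s t hs ht => simp [hs, ht]

theorem sR_map_val (B C : Subalgebra ℂ A) (ω : A →ₗ[ℂ] ℂ) (T : ↥B ⊗[ℂ] ↥C) :
    sR ω (TensorProduct.map B.val.toLinearMap C.val.toLinearMap T) =
      ((sR (ω ∘ₗ B.val.toLinearMap) T : ↥C) : A) := by
  induction T with
  | zero => simp
  | tmul u v => simp [sR_tmul_s8]
  | add s t hs ht => simp [hs, ht]

theorem coe_mem_span_sL (B C : Subalgebra ℂ A) (E' : ↥B ⊗[ℂ] ↥C)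
    (hfull : Submodule.span ℂ {x : ↥B | ∃ ω : ↥C →ₗ[ℂ] ℂ, x = sL ω E'} = ⊤) (x : ↥B) :
    (x : A) ∈ Submodule.span ℂ {a : A | ∃ ω : A →ₗ[ℂ] ℂ,
      a = sL ω (TensorProduct.map B.val.toLinearMap C.val.toLinearMap E')} := by
  have hx : x ∈ Submodule.span ℂ {x : ↥B | ∃ ω : ↥C →ₗ[ℂ] ℂ, x = sL ω E'} := hfull ▸ trivial
  induction hx using Submodule.span_induction with
  | mem y hy =>
    obtain ⟨ω, rfl⟩ := hy
    obtain ⟨η, hη⟩ := LinearMap.exists_extend (p := Subalgebra.toSubmodule C) ω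
    refine Submodule.subset_span ⟨η, ?_⟩
    rw [sL_map_val]
    exact congrArg (fun ξ : ↥C →ₗ[ℂ] ℂ => ((sL ξ E' : ↥B) : A)) hη.symm
  | zero => exact Submodule.zero_mem _
  | add y z _ _ hy hz => exact Submodule.add_mem _ hy hz
  | smul c y _ hy => exact Submodule.smul_mem _ c hy

theorem coe_mem_span_sR (B C : Subalgebra ℂ A) (E' : ↥B ⊗[ℂ] ↥C)
    (hfull : Submodule.span ℂ {y : ↥C | ∃ ω : ↥B →ₗ[ℂ] ℂ, y = sR ω E'} = ⊤) (y : ↥C) :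
    (y : A) ∈ Submodule.span ℂ {a : A | ∃ ω : A →ₗ[ℂ] ℂ,
      a = sR ω (TensorProduct.map B.val.toLinearMap C.val.toLinearMap E')} := by
  have hy : y ∈ Submodule.span ℂ {y : ↥C | ∃ ω : ↥B →ₗ[ℂ] ℂ, y = sR ω E'} := hfull ▸ trivial
  induction hy using Submodule.span_induction with
  | mem z hz =>
    obtain ⟨ω, rfl⟩ := hz
    obtain ⟨η, hη⟩ := LinearMap.exists_extend (p := Subalgebra.toSubmodule B) ω
    refine Submodule.subset_span ⟨η, ?_⟩
    rw [sR_map_val]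
    exact congrArg (fun ξ : ↥B →ₗ[ℂ] ℂ => ((sR ξ E' : ↥C) : A)) hη.symm
  | zero => exact Submodule.zero_mem _
  | add y z _ _ hy hz => exact Submodule.add_mem _ hy hz
  | smul c y _ hy => exact Submodule.smul_mem _ c hy

theorem comul_one_eq (Δ : A →ₗ[ℂ] A ⊗[ℂ] A)
    (hΔmul : ∀ a a' : A, Δ (a * a') = Δ a * Δ a') (E : A ⊗[ℂ] A)
    (hΔE : ∀ a : A, Δ a * E = Δ a)
    (hran : (Submodule.span ℂ {y : A ⊗[ℂ] A | ∃ a z, y = Δ a * z} : Set (A ⊗[ℂ] A)) =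
      {y : A ⊗[ℂ] A | ∃ z, y = E * z}) : Δ 1 = E := by
  have hE : E ∈ Submodule.span ℂ {y : A ⊗[ℂ] A | ∃ a z, y = Δ a * z} := by
    rw [← SetLike.mem_coe, hran]
    exact ⟨1, (mul_one E).symm⟩
  have hfix : Δ 1 * E = E := by
    clear hΔE hran
    induction hE using Submodule.span_induction with
    | mem y hy =>
      obtain ⟨a, z, rfl⟩ := hy
      rw [← mul_assoc, ← hΔmul, one_mul]
    | zero => exact mul_zero _
    | add y z _ _ hy hz => rw [mul_add, hy, hz]
    | smul c y _ hy => rw [mul_smul_comm, hy]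
  rw [← hΔE 1, hfix]

end Slices

theorem statement8
    (A : Type) [Ring A] [Algebra ℂ A]
    (Δ : A →ₗ[ℂ] A ⊗[ℂ] A)
    (hΔmul : ∀ a a' : A, Δ (a * a') = Δ a * Δ a')
    (hΔcoassoc : ∀ a : A,
      TensorProduct.assoc ℂ A A A (LinearMap.rTensor A Δ (Δ a)) = LinearMap.lTensor A Δ (Δ a))
    (hΔfullL : Submodule.span ℂ {x : A | ∃ ω : A →ₗ[ℂ] ℂ, ∃ a : A, x = sL ω (Δ a)} = ⊤)
    (hΔfullR : Submodule.span ℂ {x : A | ∃ ω : A →ₗ[ℂ] ℂ, ∃ a : A, x = sR ω (Δ a)} = ⊤)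
    (E : A ⊗[ℂ] A)
    (hEE : E * E = E)
    (hEΔ : ∀ a : A, E * Δ a = Δ a ∧ Δ a * E = Δ a)
    (hranL : (Submodule.span ℂ {y : A ⊗[ℂ] A | ∃ a z, y = Δ a * z} : Set (A ⊗[ℂ] A)) =
      {y : A ⊗[ℂ] A | ∃ z, y = E * z})
    (hranR : (Submodule.span ℂ {y : A ⊗[ℂ] A | ∃ a z, y = z * Δ a} : Set (A ⊗[ℂ] A)) =
      {y : A ⊗[ℂ] A | ∃ z, y = z * E})
    (hΔE1 : TensorProduct.assoc ℂ A A A (LinearMap.rTensor A Δ E) =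
      leg12 A E * ((1 : A) ⊗ₜ[ℂ] E))
    (hΔE2 : leg12 A E * ((1 : A) ⊗ₜ[ℂ] E) = ((1 : A) ⊗ₜ[ℂ] E) * leg12 A E)
    (B C : Subalgebra ℂ A)
    (E' : ↥B ⊗[ℂ] ↥C)
    (hE'E : TensorProduct.map B.val.toLinearMap C.val.toLinearMap E' = E)
    (hE'full1 : Submodule.span ℂ {x : ↥B | ∃ ω : ↥C →ₗ[ℂ] ℂ, x = sL ω E'} = ⊤)
    (hE'full2 : Submodule.span ℂ {y : ↥C | ∃ ω : ↥B →ₗ[ℂ] ℂ, y = sR ω E'} = ⊤)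
    (SB : ↥B ≃ₗ[ℂ] ↥C) (SC : ↥C ≃ₗ[ℂ] ↥B)
    (hSBanti : ∀ b b' : ↥B, SB (b * b') = SB b' * SB b)
    (hSCanti : ∀ c c' : ↥C, SC (c * c') = SC c' * SC c)
    (hSBrel : ∀ b : ↥B, E' * (b ⊗ₜ[ℂ] (1 : ↥C)) = E' * ((1 : ↥B) ⊗ₜ[ℂ] SB b))
    (hSCrel : ∀ c : ↥C, ((1 : ↥B) ⊗ₜ[ℂ] c) * E' = (SC c ⊗ₜ[ℂ] (1 : ↥C)) * E')
 :
    (∀ x : ↥B, Δ (x : A) = E * ((1 : A) ⊗ₜ[ℂ] (x : A)) ∧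
      E * ((1 : A) ⊗ₜ[ℂ] (x : A)) = ((1 : A) ⊗ₜ[ℂ] (x : A)) * E) ∧
    (∀ y : ↥C, Δ (y : A) = ((y : A) ⊗ₜ[ℂ] (1 : A)) * E ∧
      ((y : A) ⊗ₜ[ℂ] (1 : A)) * E = E * ((y : A) ⊗ₜ[ℂ] (1 : A))) := by
  have hone : Δ 1 = E := comul_one_eq Δ hΔmul E (fun a => (hEΔ a).2) hranL
  have hΔE3 : LinearMap.lTensor A Δ E = leg12 A E * ((1 : A) ⊗ₜ[ℂ] E) := by
    rw [← hΔE1, ← hone, hΔcoassoc]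
  refine ⟨fun x => ?_, fun y => ?_⟩
  · have hx := coe_mem_span_sL B C E' hE'full1 x
    rw [hE'E] at hx
    generalize (x : A) = a at hx ⊢
    induction hx using Submodule.span_induction with
    | mem a ha =>
      obtain ⟨ω, rfl⟩ := ha
      rw [← lTensor_sL_assoc_rTensor, ← lTensor_sL_leg12_mul, ← lTensor_sL_mul_leg12, hΔE1, hΔE2]
      exact ⟨rfl, rfl⟩
    | zero => simp
    | add a b _ _ ha hb =>
      simp only [map_add, TensorProduct.tmul_add, mul_add, add_mul]
      exact ⟨congrArg₂ _ ha.1 hb.1, congrArg₂ _ ha.2 hb.2⟩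
    | smul c a _ ha =>
      simp only [map_smul, TensorProduct.tmul_smul, mul_smul_comm, smul_mul_assoc]
      exact ⟨congrArg _ ha.1, congrArg _ ha.2⟩
  · have hy := coe_mem_span_sR B C E' hE'full2 y
    rw [hE'E] at hy
    generalize (y : A) = a at hy ⊢
    induction hy using Submodule.span_induction with
    | mem a ha =>
      obtain ⟨ω, rfl⟩ := ha
      rw [← sR_lTensor, ← sR_leg12_mul, ← sR_mul_leg12, hΔE3, hΔE2]
      exact ⟨rfl, rfl⟩
    | zero => simp
    | add a b _ _ ha hb =>
      simp only [map_add, TensorProduct.add_tmul, mul_add, add_mul]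
      exact ⟨congrArg₂ _ ha.1 hb.1, congrArg₂ _ ha.2 hb.2⟩
    | smul c a _ ha =>
      simp only [map_smul, ← TensorProduct.smul_tmul', mul_smul_comm, smul_mul_assoc]
      exact ⟨congrArg _ ha.1, congrArg _ ha.2⟩
end

section
/- Under the standing hypotheses in the context, if there is a faithful set of left integrals, then the set {(id ⊗ φ)(Δ(a)·(1 ⊗ b)) : φ a left integral, a, b ∈ A} spans A. -/
open TensorProduct

/-- A left integral: a nonzero functional with `(id ⊗ φ)(Δ a) ∈ C` for all `a`. -/
noncomputable def IsLeftIntegral (A : Type) [Ring A] [Algebra ℂ A] (Δ : A →ₗ[ℂ] A ⊗[ℂ] A)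
    (C : Subalgebra ℂ A) (φ : A →ₗ[ℂ] ℂ) : Prop :=
  φ ≠ 0 ∧ ∀ a : A, sL φ (Δ a) ∈ C

/-- A right integral: a nonzero functional with `(ψ ⊗ id)(Δ a) ∈ B` for all `a`. -/
noncomputable def IsRightIntegral (A : Type) [Ring A] [Algebra ℂ A] (Δ : A →ₗ[ℂ] A ⊗[ℂ] A)
    (B : Subalgebra ℂ A) (ψ : A →ₗ[ℂ] ℂ) : Prop :=
  ψ ≠ 0 ∧ ∀ a : A, sR ψ (Δ a) ∈ B

/-- There is a faithful set of left integrals. -/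
noncomputable def FaithfulLeftIntegrals (A : Type) [Ring A] [Algebra ℂ A]
    (Δ : A →ₗ[ℂ] A ⊗[ℂ] A) (C : Subalgebra ℂ A) : Prop :=
  (∀ a : A, (∀ φ : A →ₗ[ℂ] ℂ, IsLeftIntegral A Δ C φ → ∀ b : A, φ (a * b) = 0) → a = 0) ∧
  (∀ a : A, (∀ φ : A →ₗ[ℂ] ℂ, IsLeftIntegral A Δ C φ → ∀ b : A, φ (b * a) = 0) → a = 0)

/-- There is a faithful set of right integrals. -/
noncomputable def FaithfulRightIntegrals (A : Type) [Ring A] [Algebra ℂ A]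
    (Δ : A →ₗ[ℂ] A ⊗[ℂ] A) (B : Subalgebra ℂ A) : Prop :=
  (∀ a : A, (∀ ψ : A →ₗ[ℂ] ℂ, IsRightIntegral A Δ B ψ → ∀ b : A, ψ (a * b) = 0) → a = 0) ∧
  (∀ a : A, (∀ ψ : A →ₗ[ℂ] ℂ, IsRightIntegral A Δ B ψ → ∀ b : A, ψ (b * a) = 0) → a = 0)

/-- Slicing both legs of a tensor by functionals does not depend on the order of the slices. -/
theorem apply_sL_eq_apply_sR {B C : Type} [AddCommGroup B] [Module ℂ B] [AddCommGroup C]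
    [Module ℂ C] (ω : B →ₗ[ℂ] ℂ) (ρ : C →ₗ[ℂ] ℂ) (t : B ⊗[ℂ] C) :
    ω (sL ρ t) = ρ (sR ω t) := by
  induction t with
  | zero => simp
  | tmul x y => simp [sL, sR, mul_comm]
  | add x y hx hy => simp only [map_add, hx, hy]

/-- Right multiplication in the second leg commutes with slicing the first leg. -/
theorem sR_mul_one_tmul_s12 {A : Type} [Ring A] [Algebra ℂ A] (ω : A →ₗ[ℂ] ℂ) (t : A ⊗[ℂ] A) (b : A) :
    sR ω (t * ((1 : A) ⊗ₜ[ℂ] b)) = sR ω t * b := by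
  induction t with
  | zero => simp
  | tmul x y => simp [sR]
  | add x y hx hy => simp only [add_mul, map_add, hx, hy]


theorem statement12
    (A : Type) [Ring A] [Algebra ℂ A]
    (Δ : A →ₗ[ℂ] A ⊗[ℂ] A)
    (hΔmul : ∀ a a' : A, Δ (a * a') = Δ a * Δ a')
    (hΔcoassoc : ∀ a : A,
      TensorProduct.assoc ℂ A A A (LinearMap.rTensor A Δ (Δ a)) = LinearMap.lTensor A Δ (Δ a))
    (hΔfullL : Submodule.span ℂ {x : A | ∃ ω : A →ₗ[ℂ] ℂ, ∃ a : A, x = sL ω (Δ a)} = ⊤)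
    (hΔfullR : Submodule.span ℂ {x : A | ∃ ω : A →ₗ[ℂ] ℂ, ∃ a : A, x = sR ω (Δ a)} = ⊤)
    (E : A ⊗[ℂ] A)
    (hEE : E * E = E)
    (hEΔ : ∀ a : A, E * Δ a = Δ a ∧ Δ a * E = Δ a)
    (hranL : (Submodule.span ℂ {y : A ⊗[ℂ] A | ∃ a z, y = Δ a * z} : Set (A ⊗[ℂ] A)) =
      {y : A ⊗[ℂ] A | ∃ z, y = E * z})
    (hranR : (Submodule.span ℂ {y : A ⊗[ℂ] A | ∃ a z, y = z * Δ a} : Set (A ⊗[ℂ] A)) =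
      {y : A ⊗[ℂ] A | ∃ z, y = z * E})
    (hΔE1 : TensorProduct.assoc ℂ A A A (LinearMap.rTensor A Δ E) =
      leg12 A E * ((1 : A) ⊗ₜ[ℂ] E))
    (hΔE2 : leg12 A E * ((1 : A) ⊗ₜ[ℂ] E) = ((1 : A) ⊗ₜ[ℂ] E) * leg12 A E)
    (B C : Subalgebra ℂ A)
    (E' : ↥B ⊗[ℂ] ↥C)
    (hE'E : TensorProduct.map B.val.toLinearMap C.val.toLinearMap E' = E)
    (hE'full1 : Submodule.span ℂ {x : ↥B | ∃ ω : ↥C →ₗ[ℂ] ℂ, x = sL ω E'} = ⊤)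
    (hE'full2 : Submodule.span ℂ {y : ↥C | ∃ ω : ↥B →ₗ[ℂ] ℂ, y = sR ω E'} = ⊤)
    (SB : ↥B ≃ₗ[ℂ] ↥C) (SC : ↥C ≃ₗ[ℂ] ↥B)
    (hSBanti : ∀ b b' : ↥B, SB (b * b') = SB b' * SB b)
    (hSCanti : ∀ c c' : ↥C, SC (c * c') = SC c' * SC c)
    (hSBrel : ∀ b : ↥B, E' * (b ⊗ₜ[ℂ] (1 : ↥C)) = E' * ((1 : ↥B) ⊗ₜ[ℂ] SB b))
    (hSCrel : ∀ c : ↥C, ((1 : ↥B) ⊗ₜ[ℂ] c) * E' = (SC c ⊗ₜ[ℂ] (1 : ↥C)) * E')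
    (hfaithL : FaithfulLeftIntegrals A Δ C) :
    Submodule.span ℂ {x : A | ∃ φ : A →ₗ[ℂ] ℂ, IsLeftIntegral A Δ C φ ∧
      ∃ a b : A, x = sL φ (Δ a * ((1 : A) ⊗ₜ[ℂ] b))} = ⊤ := by
  by_contra hne
  obtain ⟨ω, hω, hker⟩ := Submodule.exists_le_ker_of_lt_top _ (lt_top_iff_ne_top.mpr hne)
  have hslice (a : A) : sR ω (Δ a) = 0 := by
    refine hfaithL.1 _ fun φ hφ b => ?_
    rw [← sR_mul_one_tmul_s12, ← apply_sL_eq_apply_sR]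
    exact hker (Submodule.subset_span ⟨φ, hφ, a, b, rfl⟩)
  have htop : (⊤ : Submodule ℂ A) ≤ LinearMap.ker ω := by
    rw [← hΔfullL, Submodule.span_le]
    rintro _ ⟨ρ, a, rfl⟩
    change ω (sL ρ (Δ a)) = 0
    rw [apply_sL_eq_apply_sR, hslice, map_zero]
  exact hω (LinearMap.ker_eq_top.mp (top_le_iff.mp htop))
end
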